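/- Let k, t₁, …, t_m ∈ ℂ with t_i + t_j ∉ 2Γ for all 1 ≤ i ≠ j ≤ m, and suppose ψ(z) = e^{kz}·Π_{i=1}^{m} σ(z + t_i) belongs to Q. Then every entire function ψ̃ ∈ Q that has the same quasi-periodicity multipliers as ψ (i.e. ψ̃(z + 2ω_s)·ψ(z) = ψ(z + 2ω_s)·ψ̃(z) for s = 1, 2 and all z) is a constant multiple of ψ: there exists C ∈ ℂ with ψ̃(z) = C·ψ(z) for all z. -/

import Mathlib

open Filter Topology

/-- Membership in the space `Q` of entire functions satisfying the Bethe-type conditions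
at all points `ω ∈ ω_s + 2Γ` (with `η(ω) = n₁η₁ + n₂η₂` for `ω = n₁ω₁ + n₂ω₂ ∈ Γ`,
so that `η(ω_s + 2(n₁ω₁ + n₂ω₂)) = η_s + 2(n₁η₁ + n₂η₂)`). -/
def memQ (ω η : Fin 4 → ℂ) (ω1 ω2 η1 η2 γ : ℂ) (m : ℕ) (mi mi' : Fin 4 → ℕ)
    (ψ : ℂ → ℂ) : Prop :=
  Differentiable ℂ ψ ∧
  ∀ s : Fin 4, ∀ n1 n2 : ℤ,
    (∀ j : ℕ, 1 ≤ j → j ≤ mi s →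
      ψ (ω s + 2 * ((n1 : ℂ) * ω1 + (n2 : ℂ) * ω2) + 2 * (j : ℂ) * γ) =
        ψ (ω s + 2 * ((n1 : ℂ) * ω1 + (n2 : ℂ) * ω2) - 2 * (j : ℂ) * γ) *
          Complex.exp (4 * (j : ℂ) * γ * (m : ℂ) *
            (η s + 2 * ((n1 : ℂ) * η1 + (n2 : ℂ) * η2)))) ∧
    (∀ j : ℕ, 1 ≤ j → j ≤ mi' s →
      ψ (ω s + 2 * ((n1 : ℂ) * ω1 + (n2 : ℂ) * ω2) + (2 * (j : ℂ) - 1) * γ) =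
        ψ (ω s + 2 * ((n1 : ℂ) * ω1 + (n2 : ℂ) * ω2) - (2 * (j : ℂ) - 1) * γ) *
          Complex.exp ((4 * (j : ℂ) - 2) * γ * (m : ℂ) *
            (η s + 2 * ((n1 : ℂ) * η1 + (n2 : ℂ) * η2))))

section EntireFunctions

/-- An entire function which is doubly periodic is constant. -/
lemma exists_eq_const_of_doubly_periodic {ω1 ω2 : ℂ} (hind : LinearIndependent ℝ ![ω1, ω2])
    {h : ℂ → ℂ} (hd : Differentiable ℂ h) (h1 : Function.Periodic h (2 * ω1))
    (h2 : Function.Periodic h (2 * ω2)) : ∃ C, ∀ z, h z = C := by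
  let b := basisOfLinearIndependentOfCardEqFinrank hind (by simp)
  have hb0 : b 0 = ω1 := by simp [b]
  have hb1 : b 1 = ω2 := by simp [b]
  let K : Set ℂ := (fun p : ℝ × ℝ => (p.1 : ℂ) * (2 * ω1) + (p.2 : ℂ) * (2 * ω2)) ''
    (Set.Icc 0 1 ×ˢ Set.Icc 0 1)
  have hK : IsCompact K := (isCompact_Icc.prod isCompact_Icc).image (by fun_prop)
  refine hd.exists_const_forall_eq_of_bounded
    ((hK.image hd.continuous).isBounded.subset ?_)
  rintro _ ⟨z, rfl⟩
  have hz := b.sum_repr z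
  rw [Fin.sum_univ_two, hb0, hb1] at hz
  set x := b.repr z 0
  set y := b.repr z 1
  refine ⟨_, ⟨(Int.fract (x / 2), Int.fract (y / 2)),
    ⟨⟨Int.fract_nonneg _, (Int.fract_lt_one _).le⟩, Int.fract_nonneg _,
      (Int.fract_lt_one _).le⟩, rfl⟩, ?_⟩
  have e : z = (Int.fract (x / 2) : ℝ) * (2 * ω1) + (Int.fract (y / 2) : ℝ) * (2 * ω2)
      + ⌊x / 2⌋ * (2 * ω1) + ⌊y / 2⌋ * (2 * ω2) := by
    rw [← hz]
    simp only [Complex.real_smul, Int.fract]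
    push_cast
    ring
  rw [e, h2.int_mul _ _, h1.int_mul _ _]

/-- Two continuous functions agree if they agree after multiplication by a function whose zero
set is countable. -/
lemma eq_of_mul_eq_mul_of_countable_zeros {P a b : ℂ → ℂ} (hP : {z | P z = 0}.Countable)
    (ha : Continuous a) (hb : Continuous b) (h : ∀ z, P z * a z = P z * b z) (z : ℂ) :
    a z = b z :=
  congrFun (Continuous.ext_on (hP.dense_compl ℂ) ha hb
    fun z hz => mul_left_cancel₀ hz (h z)) z

lemma countable_zeros_prod {ι : Type*} (S : Finset ι) {g : ι → ℂ → ℂ}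
    (hg : ∀ i ∈ S, {z | g i z = 0}.Countable) : {z | ∏ i ∈ S, g i z = 0}.Countable := by
  refine (S.countable_toSet.biUnion hg).mono fun z hz => ?_
  obtain ⟨i, hi, h0⟩ := Finset.prod_eq_zero_iff.mp hz
  exact Set.mem_biUnion hi h0

/-- If all zeros of the entire function `g` are simple and the entire function `f` vanishes there,
then `g` divides `f` in the ring of entire functions. -/
lemma exists_entire_eq_mul {f g : ℂ → ℂ} (hf : Differentiable ℂ f) (hg : Differentiable ℂ g)
    (hsimple : ∀ z, g z = 0 → deriv g z ≠ 0) (hfg : ∀ z, g z = 0 → f z = 0) :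
    ∃ h : ℂ → ℂ, Differentiable ℂ h ∧ ∀ z, f z = h z * g z := by
  classical
  have hds (u : ℂ → ℂ) (hu : Differentiable ℂ u) (c : ℂ) : Differentiable ℂ (dslope u c) :=
    differentiableOn_univ.mp
      ((Complex.differentiableOn_dslope Filter.univ_mem).mpr hu.differentiableOn)
  refine ⟨fun z => if g z = 0 then deriv f z / deriv g z else f z / g z, fun c => ?_,
    fun z => ?_⟩
  · by_cases hc : g c = 0
    · have hne : dslope g c c ≠ 0 := by rw [dslope_same]; exact hsimple c hc
      refine DifferentiableAt.congr_of_eventuallyEq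
        ((hds f hf c c).div (hds g hg c c) hne) ?_
      filter_upwards [(hds g hg c).continuous.continuousAt.eventually_ne hne] with z hz
      by_cases hzc : z = c
      · subst hzc
        simp [hc]
      · have hgz : g z = (z - c) * dslope g c z := by
          simpa [hc] using (sub_smul_dslope g c z).symm
        have hfz : f z = (z - c) * dslope f c z := by
          simpa [hfg c hc] using (sub_smul_dslope f c z).symm
        have h0 : z - c ≠ 0 := sub_ne_zero.mpr hzc
        rw [if_neg (by rw [hgz]; exact mul_ne_zero h0 hz), hgz, hfz]
        simp only [Pi.div_apply]
        rw [mul_div_mul_left _ _ h0]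
    · refine DifferentiableAt.congr_of_eventuallyEq ((hf c).div (hg c) hc) ?_
      filter_upwards [hg.continuous.continuousAt.eventually_ne hc] with z hz
      simp [hz]
  · by_cases hz : g z = 0
    · simp [hz, hfg z hz]
    · simp [hz]

/-- Successive division of an entire function by entire functions with simple zeros. -/
lemma exists_entire_eq_mul_prod {ι : Type*} (S : Finset ι) {f : ℂ → ℂ} {g : ι → ℂ → ℂ}
    (hf : Differentiable ℂ f) (hg : ∀ i ∈ S, Differentiable ℂ (g i))
    (hsimple : ∀ i ∈ S, ∀ z, g i z = 0 → deriv (g i) z ≠ 0)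
    (hstep : ∀ T ⊆ S, ∀ j ∈ S, j ∉ T → ∀ h : ℂ → ℂ, Differentiable ℂ h →
      (∀ z, f z = h z * ∏ i ∈ T, g i z) → ∀ z, g j z = 0 → h z = 0) :
    ∃ h : ℂ → ℂ, Differentiable ℂ h ∧ ∀ z, f z = h z * ∏ i ∈ S, g i z := by
  classical
  suffices H : ∀ T ⊆ S, ∃ h : ℂ → ℂ, Differentiable ℂ h ∧ ∀ z, f z = h z * ∏ i ∈ T, g i z from
    H S subset_rfl
  intro T
  induction T using Finset.induction_on with
  | empty => exact fun _ => ⟨f, hf, by simp⟩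
  | insert j T hj ih =>
    intro hTS
    obtain ⟨hjS, hT⟩ := Finset.insert_subset_iff.mp hTS
    obtain ⟨h, hd, hh⟩ := ih hT
    obtain ⟨h', hd', hh'⟩ := exists_entire_eq_mul hd (hg j hjS) (hsimple j hjS)
      (hstep T hT j hjS hj h hd hh)
    refine ⟨h', hd', fun z => ?_⟩
    rw [Finset.prod_insert hj, hh, hh', mul_assoc]

end EntireFunctions

section Bracket

/-- The common periods `v` of `f` and `g` up to a common nonvanishing multiplier. -/
def commonQuasiPeriods (f g : ℂ → ℂ) : AddSubgroup ℂ where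
  carrier := {v | ∀ z, ∃ c : ℂ, c ≠ 0 ∧ f (z + v) = c * f z ∧ g (z + v) = c * g z}
  zero_mem' z := ⟨1, one_ne_zero, by simp, by simp⟩
  add_mem' {v w} hv hw z := by
    obtain ⟨c, hc, hf, hg⟩ := hv z
    obtain ⟨d, hd, hf', hg'⟩ := hw (z + v)
    refine ⟨d * c, mul_ne_zero hd hc, ?_, ?_⟩
    · rw [← add_assoc, hf', hf, mul_assoc]
    · rw [← add_assoc, hg', hg, mul_assoc]
  neg_mem' {v} hv z := by
    obtain ⟨c, hc, hf, hg⟩ := hv (z + -v)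
    rw [neg_add_cancel_right] at hf hg
    refine ⟨c⁻¹, inv_ne_zero hc, ?_, ?_⟩
    · rw [hf, inv_mul_cancel_left₀ hc]
    · rw [hg, inv_mul_cancel_left₀ hc]

lemma lattice_mem_commonQuasiPeriods {f g : ℂ → ℂ} {ω1 ω2 : ℂ}
    (h1 : 2 * ω1 ∈ commonQuasiPeriods f g) (h2 : 2 * ω2 ∈ commonQuasiPeriods f g) (n1 n2 : ℤ) :
    2 * ((n1 : ℂ) * ω1 + (n2 : ℂ) * ω2) ∈ commonQuasiPeriods f g := by
  have e : 2 * ((n1 : ℂ) * ω1 + (n2 : ℂ) * ω2) = n1 • (2 * ω1) + n2 • (2 * ω2) := by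
    simp only [zsmul_eq_mul]
    ring
  rw [e]
  exact add_mem (zsmul_mem h1 n1) (zsmul_mem h2 n2)

/-- The antisymmetrization of `g(z) f(-z)`. -/
def reflectionBracket (f g : ℂ → ℂ) (z : ℂ) : ℂ := g z * f (-z) - g (-z) * f z

lemma differentiable_reflectionBracket {f g : ℂ → ℂ} (hf : Differentiable ℂ f)
    (hg : Differentiable ℂ g) : Differentiable ℂ (reflectionBracket f g) := by
  unfold reflectionBracket
  fun_prop

lemma reflectionBracket_add_eq_zero {f g : ℂ → ℂ} {v : ℂ} (hv : v ∈ commonQuasiPeriods f g)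
    {z : ℂ} (hz : reflectionBracket f g z = 0) : reflectionBracket f g (z + v) = 0 := by
  obtain ⟨c, -, hf, hg⟩ := hv z
  obtain ⟨d, hd, hf', hg'⟩ := hv (-(z + v))
  rw [show -(z + v) + v = -z by ring] at hf' hg'
  unfold reflectionBracket at hz ⊢
  rw [hf', hg'] at hz
  apply mul_left_cancel₀ hd
  rw [hf, hg]
  linear_combination c * hz

lemma reflectionBracket_eq_zero_of_symm {f g : ℂ → ℂ} {w : ℂ}
    (hw : 2 * w ∈ commonQuasiPeriods f g) {x : ℂ}
    (hx : g (w + x) * f (w - x) = g (w - x) * f (w + x)) :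
    reflectionBracket f g (w + x) = 0 := by
  obtain ⟨d, hd, hf, hg⟩ := hw (-(w + x))
  rw [show -(w + x) + 2 * w = w - x by ring] at hf hg
  unfold reflectionBracket
  rw [hf, hg] at hx
  apply mul_left_cancel₀ hd
  linear_combination hx

lemma reflectionBracket_add_of_multiplier {f g : ℂ → ℂ} {A w c : ℂ}
    (hf : ∀ z, f (z + 2 * w) = A * Complex.exp (2 * c * z) * f z)
    (hg : ∀ z, g (z + 2 * w) = A * Complex.exp (2 * c * z) * g z) (z : ℂ) :
    reflectionBracket f g (z + 2 * w) =
      Complex.exp (4 * c * (z + w)) * reflectionBracket f g z := by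
  have hf' := hf (-(z + 2 * w))
  have hg' := hg (-(z + 2 * w))
  rw [show -(z + 2 * w) + 2 * w = -z by ring] at hf' hg'
  unfold reflectionBracket
  have e : Complex.exp (4 * c * (z + w)) * Complex.exp (2 * c * -(z + 2 * w)) =
      Complex.exp (2 * c * z) := by
    rw [← Complex.exp_add]
    ring_nf
  rw [hf, hg, hf', hg']
  linear_combination (-A * (g z * f (-(z + 2 * w)) - g (-(z + 2 * w)) * f z)) * e

end Bracket

section Sigma

/-- The quasi-periodicity of `e^{kz} ∏ᵢ σ(z + tᵢ)`. -/
lemma exists_multiplier_exp_mul_prod_sigma {σ : ℂ → ℂ} {w e : ℂ}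
    (hσ : ∀ z, σ (z + 2 * w) = -σ z * Complex.exp (2 * e * (z + w))) (m : ℕ) (k : ℂ)
    (t : Fin m → ℂ) : ∃ A : ℂ, A ≠ 0 ∧ ∀ z,
      Complex.exp (k * (z + 2 * w)) * ∏ i, σ (z + 2 * w + t i) =
        A * Complex.exp (2 * (m * e) * z) * (Complex.exp (k * z) * ∏ i, σ (z + t i)) := by
  refine ⟨Complex.exp (2 * k * w) * ∏ i, (-Complex.exp (2 * e * (t i + w))),
    mul_ne_zero (Complex.exp_ne_zero _)
      (Finset.prod_ne_zero_iff.mpr fun i _ => neg_ne_zero.mpr (Complex.exp_ne_zero _)),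
    fun z => ?_⟩
  have h1 (i : Fin m) : σ (z + 2 * w + t i) =
      -Complex.exp (2 * e * (t i + w)) * Complex.exp (2 * e * z) * σ (z + t i) := by
    rw [show z + 2 * w + t i = z + t i + 2 * w by ring, hσ,
      show 2 * e * (z + t i + w) = 2 * e * (t i + w) + 2 * e * z by ring, Complex.exp_add]
    ring
  have h2 : Complex.exp (2 * (m * e) * z) = Complex.exp (2 * e * z) ^ m := by
    rw [← Complex.exp_nat_mul]
    ring_nf
  rw [Finset.prod_congr rfl fun i _ => h1 i, Finset.prod_mul_distrib, Finset.prod_mul_distrib,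
    Finset.prod_const, Finset.card_univ, Fintype.card_fin, h2,
    show k * (z + 2 * w) = 2 * k * w + k * z by ring, Complex.exp_add]
  ring

/-- A product of two shifted sigma functions with zeros symmetric about `w`. -/
noncomputable def sigmaPair (σ : ℂ → ℂ) (w e x z : ℂ) : ℂ :=
  σ (z - w - x) * σ (z - w + x) * Complex.exp (2 * e * z)

lemma sigmaPair_eq_zero_iff {σ : ℂ → ℂ} {w e x z : ℂ} :
    sigmaPair σ w e x z = 0 ↔ σ (z - w - x) = 0 ∨ σ (z - w + x) = 0 := by
  simp [sigmaPair, Complex.exp_ne_zero]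

lemma differentiable_sigmaPair {σ : ℂ → ℂ} (hσ : Differentiable ℂ σ) (w e x : ℂ) :
    Differentiable ℂ (sigmaPair σ w e x) := by
  unfold sigmaPair
  fun_prop

lemma deriv_sigmaPair_ne_zero {σ : ℂ → ℂ} (hσ : Differentiable ℂ σ)
    (hsimple : ∀ z, σ z = 0 → deriv σ z ≠ 0) {w e x z : ℂ}
    (hx : ¬(σ (z - w - x) = 0 ∧ σ (z - w + x) = 0)) (hz : sigmaPair σ w e x z = 0) :
    deriv (sigmaPair σ w e x) z ≠ 0 := by
  have d1 : HasDerivAt (fun z => σ (z - w - x)) (deriv σ (z - w - x)) z := by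
    simpa [Function.comp_def] using
      (hσ (z - w - x)).hasDerivAt.comp z (((hasDerivAt_id z).sub_const w).sub_const x)
  have d2 : HasDerivAt (fun z => σ (z - w + x)) (deriv σ (z - w + x)) z := by
    simpa [Function.comp_def] using
      (hσ (z - w + x)).hasDerivAt.comp z (((hasDerivAt_id z).sub_const w).add_const x)
  have d3 : HasDerivAt (fun z => Complex.exp (2 * e * z))
      (deriv (fun z => Complex.exp (2 * e * z)) z) z :=
    DifferentiableAt.hasDerivAt (by fun_prop)
  have d := ((d1.mul d2).mul d3).deriv
  change deriv (sigmaPair σ w e x) z = _ at d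
  have hexp := Complex.exp_ne_zero (2 * e * z)
  rw [d]
  rcases sigmaPair_eq_zero_iff.mp hz with h | h
  · have h' : σ (z - w + x) ≠ 0 := fun h' => hx ⟨h, h'⟩
    simpa [h] using ⟨hsimple _ h, h'⟩
  · have h' : σ (z - w - x) ≠ 0 := fun h' => hx ⟨h', h⟩
    simpa [h] using ⟨h', hsimple _ h⟩

lemma sigmaPair_add {σ : ℂ → ℂ} {w' e' : ℂ}
    (hσ : ∀ z, σ (z + 2 * w') = -σ z * Complex.exp (2 * e' * (z + w'))) {w e : ℂ}
    (h : Complex.exp (4 * (e * w' - e' * w)) = 1) (x z : ℂ) :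
    sigmaPair σ w e x (z + 2 * w') =
      Complex.exp (4 * e' * (z + w')) * sigmaPair σ w e x z := by
  unfold sigmaPair
  have key : Complex.exp (2 * e' * (z - w - x + w')) * Complex.exp (2 * e' * (z - w + x + w')) *
      Complex.exp (2 * e * (z + 2 * w')) =
      Complex.exp (4 * e' * (z + w')) * Complex.exp (2 * e * z) := by
    rw [← mul_one (Complex.exp (4 * e' * (z + w')) * _), ← h]
    simp only [← Complex.exp_add]
    ring_nf
  rw [show z + 2 * w' - w - x = z - w - x + 2 * w' by ring,
    show z + 2 * w' - w + x = z - w + x + 2 * w' by ring, hσ, hσ]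
  linear_combination (σ (z - w - x) * σ (z - w + x)) * key

end Sigma

section Lattice

lemma countable_zeros_sigma {ω1 ω2 : ℂ} {σ : ℂ → ℂ}
    (hσzero : ∀ z, σ z = 0 ↔ ∃ n1 n2 : ℤ, z = 2 * ((n1 : ℂ) * ω1 + (n2 : ℂ) * ω2)) (a : ℂ) :
    {z | σ (z + a) = 0}.Countable := by
  refine (Set.countable_range
    (fun p : ℤ × ℤ => 2 * ((p.1 : ℂ) * ω1 + (p.2 : ℂ) * ω2) - a)).mono fun z hz => ?_
  obtain ⟨n1, n2, h⟩ := (hσzero _).mp hz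
  exact ⟨(n1, n2), by simp [← h]⟩

lemma int_eq_zero_of_linearIndependent {ω1 ω2 : ℂ} (hind : LinearIndependent ℝ ![ω1, ω2])
    {a b : ℤ} (h : (a : ℂ) * ω1 + (b : ℂ) * ω2 = 0) : a = 0 ∧ b = 0 := by
  have := LinearIndependent.pair_iff.mp hind a b (by simpa [Complex.real_smul] using h)
  exact_mod_cast this

/-- For generic `γ`, the points `ω_s + nγ` are pairwise distinct modulo `2Γ`. -/
lemma halfPeriod_add_mul_injective {ω1 ω2 γ : ℂ} (hind : LinearIndependent ℝ ![ω1, ω2])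
    (hγ : ¬∃ q1 q2 : ℚ, γ = (q1 : ℂ) * ω1 + (q2 : ℂ) * ω2) {s s' : Fin 4} {n n' a b a' b' : ℤ}
    (h : ![0, ω1, ω2, -ω1 - ω2] s + n * γ + 2 * ((a : ℂ) * ω1 + (b : ℂ) * ω2) =
      ![0, ω1, ω2, -ω1 - ω2] s' + n' * γ + 2 * ((a' : ℂ) * ω1 + (b' : ℂ) * ω2)) :
    s = s' ∧ n = n' := by
  let A : Fin 4 → ℤ := ![0, 1, 0, -1]
  let B : Fin 4 → ℤ := ![0, 0, 1, -1]
  have hAB (s : Fin 4) : ![0, ω1, ω2, -ω1 - ω2] s = (A s : ℂ) * ω1 + (B s : ℂ) * ω2 := by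
    fin_cases s <;> (simp [A, B]; try ring)
  rw [hAB, hAB] at h
  have hn : n = n' := by
    by_contra hne
    have hne' : ((n - n' : ℤ) : ℂ) ≠ 0 := by exact_mod_cast sub_ne_zero.mpr hne
    refine hγ ⟨(A s' - A s + 2 * (a' - a) : ℤ) / (n - n' : ℤ),
      (B s' - B s + 2 * (b' - b) : ℤ) / (n - n' : ℤ), ?_⟩
    apply mul_left_cancel₀ hne'
    push_cast at hne' ⊢
    field_simp
    linear_combination h
  subst hn
  obtain ⟨h1, h2⟩ := int_eq_zero_of_linearIndependent hind
    (a := A s - A s' + 2 * (a - a')) (b := B s - B s' + 2 * (b - b')) (by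
      push_cast
      linear_combination h)
  refine ⟨?_, rfl⟩
  fin_cases s <;> fin_cases s' <;> simp [A, B] at h1 h2 ⊢ <;> omega

end Lattice

section Uniqueness

variable {ω1 ω2 η1 η2 γ : ℂ} {σ : ℂ → ℂ}

/-- The zeros of a `sigmaPair` centred at a half-period. -/
lemma exists_eq_of_sigmaPair_eq_zero
    (hσzero : ∀ z, σ z = 0 ↔ ∃ n1 n2 : ℤ, z = 2 * ((n1 : ℂ) * ω1 + (n2 : ℂ) * ω2)) {w e z : ℂ}
    {l : ℕ} (h : sigmaPair σ w e (l * γ) z = 0) :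
    ∃ n a b : ℤ, n.natAbs = l ∧ z = w + n * γ + 2 * ((a : ℂ) * ω1 + (b : ℂ) * ω2) := by
  rcases sigmaPair_eq_zero_iff.mp h with h | h <;> obtain ⟨a, b, h⟩ := (hσzero _).mp h
  · exact ⟨l, a, b, by simp, by push_cast; linear_combination h⟩
  · exact ⟨-l, a, b, by simp, by push_cast; linear_combination h⟩

/-- An entire theta function of order `2 |S|` vanishing at `0` and at the `2 |S|` points `ω_s ± lγ`,
`(s, l) ∈ S`, is identically zero. -/
lemma eq_zero_of_theta_of_vanishing (hind : LinearIndependent ℝ ![ω1, ω2])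
    (hleg : η1 * ω2 - η2 * ω1 = (Real.pi : ℂ) * Complex.I / 2)
    (hσdiff : Differentiable ℂ σ)
    (hσzero : ∀ z, σ z = 0 ↔ ∃ n1 n2 : ℤ, z = 2 * ((n1 : ℂ) * ω1 + (n2 : ℂ) * ω2))
    (hσsimple : ∀ z, σ z = 0 → deriv σ z ≠ 0)
    (hσ1 : ∀ z, σ (z + 2 * ω1) = -σ z * Complex.exp (2 * η1 * (z + ω1)))
    (hσ2 : ∀ z, σ (z + 2 * ω2) = -σ z * Complex.exp (2 * η2 * (z + ω2)))
    (hγ : ¬∃ q1 q2 : ℚ, γ = (q1 : ℂ) * ω1 + (q2 : ℂ) * ω2)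
    (S : Finset (Fin 4 × ℕ)) (hS : ∀ p ∈ S, 1 ≤ p.2) {F : ℂ → ℂ} (hF : Differentiable ℂ F)
    (hF1 : ∀ z, F (z + 2 * ω1) = Complex.exp (4 * (S.card * η1) * (z + ω1)) * F z)
    (hF2 : ∀ z, F (z + 2 * ω2) = Complex.exp (4 * (S.card * η2) * (z + ω2)) * F z)
    (hF0 : F 0 = 0)
    (hFS : ∀ p ∈ S, ∀ n a b : ℤ, n.natAbs = p.2 →
      F (![0, ω1, ω2, -ω1 - ω2] p.1 + n * γ + 2 * ((a : ℂ) * ω1 + (b : ℂ) * ω2)) = 0) (z : ℂ) :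
    F z = 0 := by
  set ω : Fin 4 → ℂ := ![0, ω1, ω2, -ω1 - ω2] with hω
  set η : Fin 4 → ℂ := ![0, η1, η2, -η1 - η2] with hη
  let g (p : Fin 4 × ℕ) : ℂ → ℂ := sigmaPair σ (ω p.1) (η p.1) (p.2 * γ)
  have hgd (p) : Differentiable ℂ (g p) := differentiable_sigmaPair hσdiff _ _ _
  have hzero {p z} (h : g p z = 0) :
      ∃ n a b : ℤ, n.natAbs = p.2 ∧ z = ω p.1 + n * γ + 2 * ((a : ℂ) * ω1 + (b : ℂ) * ω2) :=
    exists_eq_of_sigmaPair_eq_zero hσzero h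
  have hdisj {p q z} (hp : g p z = 0) (hq : g q z = 0) : p = q := by
    obtain ⟨n, a, b, hn, h⟩ := hzero hp
    obtain ⟨n', a', b', hn', h'⟩ := hzero hq
    obtain ⟨h1, h2⟩ := halfPeriod_add_mul_injective hind hγ (h.symm.trans h')
    exact Prod.ext h1 (by rw [← hn, ← hn', h2])
  have hsimple : ∀ p ∈ S, ∀ z, g p z = 0 → deriv (g p) z ≠ 0 := by
    refine fun p hp z hz => deriv_sigmaPair_ne_zero hσdiff hσsimple ?_ hz
    rintro ⟨h, h'⟩
    obtain ⟨a, b, h⟩ := (hσzero _).mp h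
    obtain ⟨a', b', h'⟩ := (hσzero _).mp h'
    have := (halfPeriod_add_mul_injective (s := p.1) (s' := p.1) (n := p.2) (n' := -p.2)
      (a := a) (b := b) (a' := a') (b' := b') hind hγ (by
        push_cast
        linear_combination h' - h)).2
    have := hS p hp
    omega
  obtain ⟨h, hd, hh⟩ := exists_entire_eq_mul_prod S hF (fun p _ => hgd p) hsimple (by
    intro T hT j hj hjT u hu huT z hz
    obtain ⟨n, a, b, hn, rfl⟩ := hzero hz
    refine (mul_eq_zero.mp ((huT _).symm.trans (hFS j hj n a b hn))).resolve_right ?_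
    refine Finset.prod_ne_zero_iff.mpr fun i hi h0 => hjT ?_
    rwa [← hdisj h0 hz])
  have hcount : {z | ∏ p ∈ S, g p z = 0}.Countable := by
    refine countable_zeros_prod S fun p _ => ?_
    refine ((countable_zeros_sigma hσzero (-ω p.1 - p.2 * γ)).union
      (countable_zeros_sigma hσzero (-ω p.1 + p.2 * γ))).mono fun z hz => ?_
    rcases sigmaPair_eq_zero_iff.mp hz with h | h
    · left
      rwa [sub_sub, sub_eq_add_neg, neg_add'] at h
    · right
      rwa [sub_eq_add_neg, add_assoc] at h
  have hperiodic {w' e' : ℂ}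
      (hσ' : ∀ z, σ (z + 2 * w') = -σ z * Complex.exp (2 * e' * (z + w')))
      (hF' : ∀ z, F (z + 2 * w') = Complex.exp (4 * (S.card * e') * (z + w')) * F z)
      (hexp : ∀ s, Complex.exp (4 * (η s * w' - e' * ω s)) = 1) :
      Function.Periodic h (2 * w') := by
    refine eq_of_mul_eq_mul_of_countable_zeros hcount
      (hd.continuous.comp (continuous_id.add continuous_const)) hd.continuous fun z => ?_
    have hp : ∏ p ∈ S, g p (z + 2 * w') =
        Complex.exp (4 * (S.card * e') * (z + w')) * ∏ p ∈ S, g p z := by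
      rw [Finset.prod_congr rfl fun p _ => sigmaPair_add hσ' (hexp p.1) (p.2 * γ) z,
        Finset.prod_mul_distrib, Finset.prod_const, ← Complex.exp_nat_mul,
        show (S.card : ℂ) * (4 * e' * (z + w')) = 4 * (S.card * e') * (z + w') by ring]
    have := hF' z
    rw [hh, hh, hp] at this
    apply mul_left_cancel₀ (Complex.exp_ne_zero (4 * (S.card * e') * (z + w')))
    linear_combination this
  have hexp1 : Complex.exp (4 * (η1 * ω2 - η2 * ω1)) = 1 := by
    rw [hleg, ← Complex.exp_two_pi_mul_I]
    ring_nf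
  have hexp2 : Complex.exp (4 * (η2 * ω1 - η1 * ω2)) = 1 := by
    rw [← neg_sub, mul_neg, Complex.exp_neg, hexp1, inv_one]
  have e1 : (-η1 - η2) * ω1 - η1 * (-ω1 - ω2) = η1 * ω2 - η2 * ω1 := by ring
  have e2 : (-η1 - η2) * ω2 - η2 * (-ω1 - ω2) = η2 * ω1 - η1 * ω2 := by ring
  obtain ⟨C, hC⟩ := exists_eq_const_of_doubly_periodic hind hd
    (hperiodic hσ1 hF1 fun s => by fin_cases s <;> simp [hω, hη, e1, hexp1, hexp2])
    (hperiodic hσ2 hF2 fun s => by fin_cases s <;> simp [hω, hη, e2, hexp1, hexp2])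
  have h0 : ∏ p ∈ S, g p 0 ≠ 0 := by
    refine Finset.prod_ne_zero_iff.mpr fun p hp h0 => ?_
    obtain ⟨n, a, b, hn, h0⟩ := hzero h0
    have := (halfPeriod_add_mul_injective (s := 0) (s' := p.1) (n := 0) (n' := n) (a := 0)
      (b := 0) hind hγ (by simpa using h0)).2
    have := hS p hp
    omega
  have hC0 : C = 0 := by
    rw [hh, hC] at hF0
    exact (mul_eq_zero.mp hF0).resolve_right h0
  rw [hh, hC, hC0, zero_mul]

/-- If the bracket of `f(z) = e^{kz} ∏ᵢ σ(z + tᵢ)` and `g` vanishes, `f` and `g` have the same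
multipliers and `tᵢ + tⱼ ∉ 2Γ` for `i ≠ j`, then `g` is a multiple of `f`. -/
lemma exists_eq_const_mul_of_reflectionBracket_eq_zero (hind : LinearIndependent ℝ ![ω1, ω2])
    (hσdiff : Differentiable ℂ σ)
    (hσzero : ∀ z, σ z = 0 ↔ ∃ n1 n2 : ℤ, z = 2 * ((n1 : ℂ) * ω1 + (n2 : ℂ) * ω2))
    (hσsimple : ∀ z, σ z = 0 → deriv σ z ≠ 0) {m : ℕ} {k : ℂ} {t : Fin m → ℂ} {f g : ℂ → ℂ}
    (hf : ∀ z, f z = Complex.exp (k * z) * ∏ i : Fin m, σ (z + t i))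
    (ht : ∀ i j : Fin m, i ≠ j →
      ¬∃ n1 n2 : ℤ, t i + t j = 2 * ((n1 : ℂ) * ω1 + (n2 : ℂ) * ω2))
    (hfd : Differentiable ℂ f) (hfc : {z | f z = 0}.Countable) (hgd : Differentiable ℂ g)
    (hper : ∀ n1 n2 : ℤ, 2 * ((n1 : ℂ) * ω1 + (n2 : ℂ) * ω2) ∈ commonQuasiPeriods f g)
    (hF : ∀ z, reflectionBracket f g z = 0) : ∃ C : ℂ, ∀ z, g z = C * f z := by
  have hfz {z} : f z = 0 ↔ ∃ i, σ (z + t i) = 0 := by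
    simp [hf, Complex.exp_ne_zero, Finset.prod_eq_zero_iff]
  have hF' (z : ℂ) : g z * f (-z) = g (-z) * f z := sub_eq_zero.mp (hF z)
  -- a common zero of `f(z)` and `f(-z)` is a half-period, and comes from a single factor
  have huniq {z i j} (hi : σ (z + t i) = 0) (hj : σ (-z + t j) = 0) : i = j := by
    by_contra hij
    obtain ⟨a, b, ha⟩ := (hσzero _).mp hi
    obtain ⟨a', b', hb⟩ := (hσzero _).mp hj
    exact ht i j hij ⟨a + a', b + b', by push_cast; linear_combination ha + hb⟩
  have hgz {z} (hz : f z = 0) (hz' : f (-z) = 0) : g z = 0 := by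
    obtain ⟨j, hj⟩ := hfz.mp hz'
    obtain ⟨i, hi⟩ := hfz.mp hz
    obtain rfl := huniq hi hj
    obtain ⟨a, b, ha⟩ := (hσzero _).mp hi
    obtain ⟨a', b', hb⟩ := (hσzero _).mp hj
    have hv : 2 * z ∈ commonQuasiPeriods f g := by
      have := hper (a - a') (b - b')
      rwa [show 2 * (((a - a' : ℤ) : ℂ) * ω1 + ((b - b' : ℤ) : ℂ) * ω2) = 2 * z by
        push_cast; linear_combination hb - ha] at this
    have hcross (w : ℂ) : g (w + 2 * z) * f w = f (w + 2 * z) * g w := by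
      obtain ⟨c, -, hc, hc'⟩ := hv w
      rw [hc, hc']
      ring
    have dshift (u : ℂ → ℂ) (hu : Differentiable ℂ u) :
        HasDerivAt (fun w => u (w + 2 * z)) (deriv u z) (-z) := by
      have : HasDerivAt u (deriv u z) (-z + 2 * z) := by
        rw [show -z + 2 * z = z by ring]
        exact (hu z).hasDerivAt
      exact this.comp_add_const (-z) (2 * z)
    have dneg (u : ℂ → ℂ) (hu : Differentiable ℂ u) :
        HasDerivAt (fun w => u (-w)) (-deriv u z) (-z) := by
      have : HasDerivAt u (deriv u z) (-(-z)) := by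
        rw [neg_neg]
        exact (hu z).hasDerivAt
      simpa [Function.comp_def] using this.scomp (-z) (hasDerivAt_neg (-z))
    have dat (u : ℂ → ℂ) (hu : Differentiable ℂ u) : HasDerivAt u (deriv u (-z)) (-z) :=
      (hu _).hasDerivAt
    have E1 := (((dshift g hgd).mul (dat f hfd)).sub ((dshift f hfd).mul (dat g hgd))).deriv
    have E2 := (((dat g hgd).mul (dneg f hfd)).sub ((dneg g hgd).mul (dat f hfd))).deriv
    rw [show ((fun w => g (w + 2 * z)) * f - (fun w => f (w + 2 * z)) * g) = fun _ => 0 from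
      funext fun w => sub_eq_zero.mpr (hcross w), deriv_const] at E1
    rw [show (g * (fun w => f (-w)) - (fun w => g (-w)) * f) = fun _ => 0 from
      funext fun w => sub_eq_zero.mpr (hF' w), deriv_const] at E2
    simp only [show -z + 2 * z = z by ring, neg_neg, hz, hz'] at E1 E2
    have hprod : g z * deriv f (-z) = 0 := by linear_combination -(E1 - E2) / 2
    refine (mul_eq_zero.mp hprod).resolve_right ?_
    have hfd' : HasDerivAt f
        (deriv σ (-z + t i) * (Complex.exp (k * -z) * ∏ l ∈ Finset.univ.erase i, σ (-z + t l)))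
        (-z) := by
      have ef : f = (fun w => σ (w + t i)) *
          (fun w => Complex.exp (k * w) * ∏ l ∈ Finset.univ.erase i, σ (w + t l)) := by
        funext w
        simp only [Pi.mul_apply]
        rw [hf, ← Finset.mul_prod_erase _ _ (Finset.mem_univ i)]
        ring
      have d1 : HasDerivAt (fun w => σ (w + t i)) (deriv σ (-z + t i)) (-z) :=
        (hσdiff _).hasDerivAt.comp_add_const _ _
      have d2 : DifferentiableAt ℂ
          (fun w => Complex.exp (k * w) * ∏ l ∈ Finset.univ.erase i, σ (w + t l)) (-z) := by
        fun_prop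
      have := d1.mul d2.hasDerivAt
      rw [hj, zero_mul, add_zero] at this
      rwa [ef]
    rw [hfd'.deriv]
    refine mul_ne_zero (hσsimple _ hj) (mul_ne_zero (Complex.exp_ne_zero _)
      (Finset.prod_ne_zero_iff.mpr fun l hl h0 => (Finset.mem_erase.mp hl).1 ?_))
    exact (huniq hi h0).symm
  have hdt (i : Fin m) : Differentiable ℂ (fun z => σ (z + t i)) := by fun_prop
  obtain ⟨h, hd, hh⟩ := exists_entire_eq_mul_prod Finset.univ (g := fun i z => σ (z + t i)) hgd
    (fun i _ => hdt i)
    (fun i _ z hz => by rw [deriv_comp_add_const]; exact hσsimple _ hz) (by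
      intro T _ j _ hjT u hu huT z hz
      have hfz0 : f z = 0 := hfz.mpr ⟨j, hz⟩
      by_cases hz' : f (-z) = 0
      · obtain ⟨l, hl⟩ := hfz.mp hz'
        refine (mul_eq_zero.mp ((huT z).symm.trans (hgz hfz0 hz'))).resolve_right ?_
        refine Finset.prod_ne_zero_iff.mpr fun i hi h0 => hjT ?_
        rwa [(huniq hz hl).trans (huniq h0 hl).symm]
      · have key := eq_of_mul_eq_mul_of_countable_zeros
          (P := fun z => ∏ i ∈ T, σ (z + t i)) (a := fun z => u z * f (-z))
          (b := fun z => g (-z) * (Complex.exp (k * z) * ∏ i ∈ Tᶜ, σ (z + t i)))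
          (countable_zeros_prod T fun i _ => countable_zeros_sigma hσzero (t i))
          (hu.continuous.mul (hfd.continuous.comp continuous_neg))
          (by
            have := hgd.continuous
            have := hσdiff.continuous
            fun_prop)
          (fun w => by
            have := hF' w
            rw [huT, hf w, ← Finset.prod_mul_prod_compl T] at this
            linear_combination this) z
        rw [Finset.prod_eq_zero (Finset.mem_compl.mpr hjT) hz, mul_zero, mul_zero] at key
        exact (mul_eq_zero.mp key).resolve_right hz')
  have hq : ∀ z, g z = (h z * Complex.exp (-(k * z))) * f z := fun z => by
    have : Complex.exp (-(k * z)) * Complex.exp (k * z) = 1 := by rw [← Complex.exp_add]; simp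
    rw [hh, hf]
    linear_combination (-h z * ∏ i, σ (z + t i)) * this
  have hqd : Differentiable ℂ (fun z => h z * Complex.exp (-(k * z))) := by fun_prop
  have hperiodic {v : ℂ} (hv : v ∈ commonQuasiPeriods f g) :
      Function.Periodic (fun z => h z * Complex.exp (-(k * z))) v := by
    refine eq_of_mul_eq_mul_of_countable_zeros hfc
      (hqd.continuous.comp (continuous_id.add continuous_const)) hqd.continuous fun z => ?_
    obtain ⟨c, hc, hc', hc''⟩ := hv z
    apply mul_left_cancel₀ hc
    rw [hq, hq z, hc'] at hc''
    linear_combination hc''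
  obtain ⟨C, hC⟩ := exists_eq_const_of_doubly_periodic hind hqd
    (hperiodic (by simpa using hper 1 0)) (hperiodic (by simpa using hper 0 1))
  exact ⟨C, fun z => by rw [hq, hC]⟩

end Uniqueness

/-- The steps `l` for which the conditions of `memQ` relate `ψ(ω + lγ)` and `ψ(ω - lγ)`. -/
def betheSteps (a b : ℕ) : Finset ℕ :=
  (Finset.Icc 1 a).image (fun j => 2 * j) ∪ (Finset.Icc 1 b).image (fun j => 2 * j - 1)

lemma card_betheSteps (a b : ℕ) : (betheSteps a b).card = a + b := by
  unfold betheSteps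
  rw [Finset.card_union_of_disjoint, Finset.card_image_of_injOn, Finset.card_image_of_injOn]
  · simp
  · intro x hx y hy h
    simp only [Finset.coe_Icc, Set.mem_Icc] at hx hy h
    omega
  · intro x _ y _ h
    simp only at h
    omega
  · rw [Finset.disjoint_left]
    simp only [Finset.mem_image, Finset.mem_Icc]
    rintro _ ⟨i, hi, rfl⟩ ⟨j, hj, h⟩
    omega

lemma pos_of_mem_betheSteps {a b l : ℕ} (h : l ∈ betheSteps a b) : 1 ≤ l := by
  simp only [betheSteps, Finset.mem_union, Finset.mem_image, Finset.mem_Icc] at h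
  omega

/-- Two members of `Q` satisfy the Bethe-type conditions with the same multipliers. -/
lemma memQ.mul_eq_mul {ω η : Fin 4 → ℂ} {ω1 ω2 η1 η2 γ : ℂ} {m : ℕ} {mi mi' : Fin 4 → ℕ}
    {f g : ℂ → ℂ} (hf : memQ ω η ω1 ω2 η1 η2 γ m mi mi' f)
    (hg : memQ ω η ω1 ω2 η1 η2 γ m mi mi' g) {s : Fin 4} {l : ℕ}
    (hl : l ∈ betheSteps (mi s) (mi' s)) :
    g (ω s + l * γ) * f (ω s - l * γ) = g (ω s - l * γ) * f (ω s + l * γ) := by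
  simp only [betheSteps, Finset.mem_union, Finset.mem_image, Finset.mem_Icc] at hl
  obtain ⟨hf1, hf2⟩ := hf.2 s 0 0
  obtain ⟨hg1, hg2⟩ := hg.2 s 0 0
  simp only [Int.cast_zero, zero_mul, add_zero, mul_zero] at hf1 hf2 hg1 hg2
  rcases hl with ⟨j, ⟨h1, h2⟩, rfl⟩ | ⟨j, ⟨h1, h2⟩, rfl⟩
  · push_cast
    rw [hf1 j h1 h2, hg1 j h1 h2]
    ring
  · rw [Nat.cast_sub (by omega)]
    push_cast
    rw [hf2 j h1 h2, hg2 j h1 h2]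
    ring

/-- **Uniqueness of the Bethe ansatz eigenfunction.** If the Bethe ansatz function
`ψ(z) = e^{kz} ∏ᵢ σ(z + tᵢ)` lies in `Q` and `tᵢ + tⱼ ∉ 2Γ` for `i ≠ j`, then any entire
`ψ̃ ∈ Q` with the same quasi-periodicity multipliers as `ψ` is a constant multiple of
`ψ`. -/
theorem bethe_eigenfunction_unique_up_to_constant
    -- the period lattice
    (ω1 ω2 : ℂ) (hind : LinearIndependent ℝ ![ω1, ω2])
    (η1 η2 : ℂ) (hleg : η1 * ω2 - η2 * ω1 = (Real.pi : ℂ) * Complex.I / 2)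
    (ω : Fin 4 → ℂ) (hω : ω = ![0, ω1, ω2, -ω1 - ω2])
    (η : Fin 4 → ℂ) (hη : η = ![0, η1, η2, -η1 - η2])
    -- the Weierstrass sigma function
    (σ : ℂ → ℂ) (hσdiff : Differentiable ℂ σ)
    (hσodd : ∀ z, σ (-z) = -σ z)
    (hσzero : ∀ z, σ z = 0 ↔ ∃ n1 n2 : ℤ, z = 2 * ((n1 : ℂ) * ω1 + (n2 : ℂ) * ω2))
    (hσsimple : ∀ z, σ z = 0 → deriv σ z ≠ 0)
    (hσnorm : deriv σ 0 = 1)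
    (hσper : ∀ s : Fin 4, s = 1 ∨ s = 2 → ∀ z,
      σ (z + 2 * ω s) = -σ z * Complex.exp (2 * η s * (z + ω s)))
    -- the step γ and the integer coupling parameters
    (γ : ℂ) (hγ : ¬∃ q1 q2 : ℚ, γ = (q1 : ℂ) * ω1 + (q2 : ℂ) * ω2)
    (mi mi' : Fin 4 → ℕ)
    (m : ℕ) (hm : m = ∑ p : Fin 4, (mi p + mi' p)) (hm1 : 1 ≤ m)
    -- the Bethe ansatz function ψ ∈ Q with tᵢ + tⱼ ∉ 2Γ
    (k : ℂ) (t : Fin m → ℂ)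
    (ψ : ℂ → ℂ) (hψ : ∀ z, ψ z = Complex.exp (k * z) * ∏ i : Fin m, σ (z + t i))
    (ht : ∀ i j : Fin m, i ≠ j →
      ¬∃ n1 n2 : ℤ, t i + t j = 2 * ((n1 : ℂ) * ω1 + (n2 : ℂ) * ω2))
    (hψQ : memQ ω η ω1 ω2 η1 η2 γ m mi mi' ψ)
    -- another member of Q with the same quasi-periodicity multipliers
    (ψt : ℂ → ℂ) (hψtQ : memQ ω η ω1 ω2 η1 η2 γ m mi mi' ψt)
    (hmult1 : ∀ z, ψt (z + 2 * ω1) * ψ z = ψ (z + 2 * ω1) * ψt z)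
    (hmult2 : ∀ z, ψt (z + 2 * ω2) * ψ z = ψ (z + 2 * ω2) * ψt z) :
    ∃ C : ℂ, ∀ z : ℂ, ψt z = C * ψ z := by
  have hψd : Differentiable ℂ ψ := hψQ.1
  have hψtd : Differentiable ℂ ψt := hψtQ.1
  have hσ1 : ∀ z, σ (z + 2 * ω1) = -σ z * Complex.exp (2 * η1 * (z + ω1)) := by
    simpa [hω, hη] using hσper 1 (Or.inl rfl)
  have hσ2 : ∀ z, σ (z + 2 * ω2) = -σ z * Complex.exp (2 * η2 * (z + ω2)) := by
    simpa [hω, hη] using hσper 2 (Or.inr rfl)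
  have hcount : {z | ψ z = 0}.Countable := by
    refine (countable_zeros_prod Finset.univ
      fun i _ => countable_zeros_sigma hσzero (t i)).mono fun z hz => ?_
    exact (mul_eq_zero.mp ((hψ z).symm.trans hz)).resolve_left (Complex.exp_ne_zero _)
  have hmul {w e : ℂ} (hσ' : ∀ z, σ (z + 2 * w) = -σ z * Complex.exp (2 * e * (z + w)))
      (hmult : ∀ z, ψt (z + 2 * w) * ψ z = ψ (z + 2 * w) * ψt z) :
      ∃ A : ℂ, A ≠ 0 ∧ (∀ z, ψ (z + 2 * w) = A * Complex.exp (2 * (m * e) * z) * ψ z) ∧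
        ∀ z, ψt (z + 2 * w) = A * Complex.exp (2 * (m * e) * z) * ψt z := by
    obtain ⟨A, hA, h⟩ := exists_multiplier_exp_mul_prod_sigma hσ' m k t
    simp only [← hψ] at h
    refine ⟨A, hA, h, eq_of_mul_eq_mul_of_countable_zeros hcount
      (hψtd.continuous.comp (continuous_id.add continuous_const))
      (by have := hψtd.continuous; fun_prop) fun z => ?_⟩
    have := hmult z
    rw [h] at this
    linear_combination this
  obtain ⟨A1, hA1, hf1, hg1⟩ := hmul hσ1 hmult1
  obtain ⟨A2, hA2, hf2, hg2⟩ := hmul hσ2 hmult2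
  have hper := lattice_mem_commonQuasiPeriods (f := ψ) (g := ψt) (ω1 := ω1) (ω2 := ω2)
    (fun z => ⟨_, mul_ne_zero hA1 (Complex.exp_ne_zero _), hf1 z, hg1 z⟩)
    (fun z => ⟨_, mul_ne_zero hA2 (Complex.exp_ne_zero _), hf2 z, hg2 z⟩)
  have hper' (s : Fin 4) : 2 * ω s ∈ commonQuasiPeriods ψ ψt := by
    rw [hω]
    fin_cases s
    · simp
    · simpa using hper 1 0
    · simpa using hper 0 1
    · simpa [sub_eq_add_neg] using hper (-1) (-1)
  let S : Finset (Fin 4 × ℕ) := (Finset.univ.sigma fun s => betheSteps (mi s) (mi' s)).map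
    (Equiv.sigmaEquivProd (Fin 4) ℕ).toEmbedding
  have hSmem {p} (hp : p ∈ S) : p.2 ∈ betheSteps (mi p.1) (mi' p.1) := by
    obtain ⟨q, hq, rfl⟩ := Finset.mem_map.mp hp
    exact (Finset.mem_sigma.mp hq).2
  have hScard : S.card = m := by
    simp [S, hm, Finset.card_sigma, card_betheSteps]
  have hF (z : ℂ) : reflectionBracket ψ ψt z = 0 := by
    refine eq_zero_of_theta_of_vanishing hind hleg hσdiff hσzero hσsimple hσ1 hσ2 hγ S
      (fun p hp => pos_of_mem_betheSteps (hSmem hp))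
      (differentiable_reflectionBracket hψd hψtd)
      (by rw [hScard]; exact reflectionBracket_add_of_multiplier hf1 hg1)
      (by rw [hScard]; exact reflectionBracket_add_of_multiplier hf2 hg2)
      (by simp [reflectionBracket]) (fun p hp n a b hn => ?_) z
    rw [← hω]
    refine reflectionBracket_add_eq_zero (hper a b) (reflectionBracket_eq_zero_of_symm
      (hper' p.1) ?_)
    have key := hψQ.mul_eq_mul hψtQ (hSmem hp)
    rcases Int.natAbs_eq n with h | h <;> rw [h, hn] <;> push_cast
    · exact key
    · rw [neg_mul, sub_neg_eq_add, ← sub_eq_add_neg]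
      exact key.symm
  exact exists_eq_const_mul_of_reflectionBracket_eq_zero hind hσdiff hσzero hσsimple hψ ht hψd
    hcount hψtd hper hF
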